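/- Let R be a commutative unital ring, α : ℤ → R a family of elements, and S_s^k(n) the associated Svinin polynomials. Then for all integers k ≥ 1, 1 ≤ s ≤ k, and all n ∈ ℤ, the factorization identity S_s^k(n) = S_{k+1}^{s−1}(n) · ∏_{j=s−1}^{k−1} α_{n−j} holds. -/

import Mathlib

/-- Svinin polynomials: `svinin α s k n` is `S_s^k(n)`, defined by
`S_s^0(n) = 1` and `S_s^k(n) = Σ_{j=0}^{s−1} α_{n−k−j+1} · S_{s−j}^{k−1}(n−j)` for `k ≥ 1`. -/
def svinin {R : Type*} [Ring R] (α : ℤ → R) : ℕ → ℕ → ℤ → R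
  | _, 0, _ => 1
  | s, k + 1, n =>
      ∑ j ∈ Finset.range s,
        α (n - ((k : ℤ) + 1) - (j : ℤ) + 1) * svinin α (s - j) k (n - (j : ℤ))

theorem svinin_zero_right {R : Type*} [Ring R] (α : ℤ → R) (s : ℕ) (n : ℤ) :
    svinin α s 0 n = 1 := by
  simp [svinin]

theorem svinin_zero_left {R : Type*} [Ring R] (α : ℤ → R) (k : ℕ) (n : ℤ) :
    svinin α 0 (k + 1) n = 0 := by
  simp [svinin]

theorem svinin_recA {R : Type*} [Ring R] (α : ℤ → R) (s k : ℕ) (n : ℤ) :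
    svinin α (s + 1) (k + 1) n =
      α (n - k) * svinin α (s + 1) k n + svinin α s (k + 1) (n - 1) := by
  rw [svinin, svinin, Finset.sum_range_succ', add_comm]
  congr 1
  · congr 2
    · push_cast; ring
    · simp
  · apply Finset.sum_congr rfl
    intro j _
    congr 2
    · push_cast; ring
    · omega
    · push_cast; ring

theorem svinin_recB {R : Type*} [CommRing R] (α : ℤ → R) (s : ℕ) : ∀ (k : ℕ) (n : ℤ),
    svinin α (s + 1) (k + 1) n =
      svinin α s (k + 1) n + α (n - s) * svinin α (s + 1) k (n - 1) := by
  induction s with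
  | zero =>
    intro k
    induction k with
    | zero => intro n; simp [svinin]
    | succ k ih =>
      intro n
      rw [svinin_recA, ih, svinin_recA α 0 k (n - 1)]
      simp only [svinin_zero_left]
      have e : n - ((k + 1 : ℕ) : ℤ) = n - 1 - k := by push_cast; ring
      rw [e]; ring
  | succ s ihs =>
    intro k
    have e : ∀ n : ℤ, n - ((s + 1 : ℕ) : ℤ) = n - 1 - s := by intro n; push_cast; ring
    induction k with
    | zero =>
      intro n
      rw [svinin_recA α (s + 1) 0 n, svinin_recA α s 0 n, ihs 0 (n - 1), e]
      simp only [svinin_zero_right]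
      ring
    | succ k ih =>
      intro n
      have e2 : n - ((k + 1 : ℕ) : ℤ) = n - 1 - k := by push_cast; ring
      rw [svinin_recA, svinin_recA α s (k + 1) n, ih, ihs (k + 1) (n - 1),
        svinin_recA α (s + 1) k (n - 1), e, e2]
      ring

theorem svinin_fact_aux {R : Type*} [CommRing R] (α : ℤ → R) (m : ℕ) : ∀ (d : ℕ) (n : ℤ),
    svinin α (m + 1) (m + d) n =
      svinin α (m + d + 1) m n * ∏ i ∈ Finset.range d, α (n - m - i) := by
  induction m with
  | zero =>
    intro d
    induction d with
    | zero => intro n; simp [svinin]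
    | succ d ih =>
      intro n
      have h := ih n
      rw [← add_assoc, svinin_recA, h, Finset.prod_range_succ]
      simp only [svinin_zero_left, svinin_zero_right]
      simp [mul_comm]
  | succ m ihm =>
    intro d
    induction d with
    | zero => intro n; simp
    | succ d ih =>
      intro n
      have h1 := ih n
      have h2 := ihm (d + 2) (n - 1)
      have e1 : m + (d + 2) = m + 1 + d + 1 := by omega
      rw [e1] at h2
      have e2 : ∀ i : ℕ, n - 1 - (m : ℤ) - i = n - ((m + 1 : ℕ) : ℤ) - i := by
        intro i; push_cast; ring
      simp only [e2] at h2
      have e3 : n - ((m + 1 + d : ℕ) : ℤ) = n - ((m + 1 : ℕ) : ℤ) - d := by push_cast; ring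
      have e4 : n - ((m + 1 + d + 1 : ℕ) : ℤ) = n - ((m + 1 : ℕ) : ℤ) - (d + 1 : ℕ) := by
        push_cast; ring
      rw [← add_assoc, svinin_recA, h1, h2, svinin_recB α (m + 1 + d + 1) m n, e3, e4,
        Finset.prod_range_succ _ (d + 1), Finset.prod_range_succ _ d]
      ring

/-- In a commutative ring, for `1 ≤ s ≤ k`:
`S_s^k(n) = S_{k+1}^{s−1}(n) · ∏_{j=s−1}^{k−1} α_{n−j}`. -/
theorem svinin_factorization {R : Type*} [CommRing R] (α : ℤ → R)
    (k s : ℕ) (hk : 1 ≤ k) (hs1 : 1 ≤ s) (hs2 : s ≤ k) (n : ℤ) :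
    svinin α s k n =
      svinin α (k + 1) (s - 1) n * ∏ j ∈ Finset.Icc (s - 1) (k - 1), α (n - (j : ℤ)) := by
  obtain ⟨m, rfl⟩ := Nat.exists_eq_add_of_le' hs1
  obtain ⟨d, rfl⟩ := Nat.exists_eq_add_of_le hs2
  have h := svinin_fact_aux α m (d + 1) n
  have e : m + (d + 1) = m + 1 + d := by omega
  rw [e] at h
  rw [h, Nat.add_sub_cancel]
  congr 1
  have e2 : Finset.Icc m (m + 1 + d - 1) = Finset.Ico m (m + 1 + d) := by
    ext x; simp only [Finset.mem_Icc, Finset.mem_Ico]; omega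
  rw [e2, Finset.prod_Ico_eq_prod_range]
  have e3 : m + 1 + d - m = d + 1 := by omega
  rw [e3]
  apply Finset.prod_congr rfl
  intro i _
  congr 1
  push_cast; ring
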